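/- Let {X_n} be an irreducible and aperiodic Markov chain on a finite alphabet A with stationary distribution π, and let P̂_{X_0,n}(a) = (1/n) Σ_{i=1}^n 1{X_{i−1}=a} be the empirical distribution of the sample. Then √(n / log log n) · D(P̂_{X_0,n} ‖ π) → 0 almost surely as n → ∞; in particular, D(P̂_{X_0,n} ‖ π) = O(log log n / n) almost surely. -/

import Mathlib

open MeasureTheory ProbabilityTheory Filter Finset Topology
open scoped NNReal

noncomputable section

/-- Shannon entropy (natural logarithm) of a probability vector on a finite type. -/
def ent {T : Type*} [Fintype T] (p : T → ℝ) : ℝ := ∑ t, Real.negMulLog (p t)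

/-- `X` is a homogeneous first-order Markov chain with transition matrix `Q`
(and arbitrary initial distribution). -/
def IsMarkov {Ω A : Type*} [MeasurableSpace Ω] (μ : Measure Ω) (X : ℕ → Ω → A)
    (Q : A → A → ℝ) : Prop :=
  ∀ (n : ℕ) (w : Fin (n + 1) → A) (a : A),
    (μ {ω | (∀ i : Fin (n + 1), X (i : ℕ) ω = w i) ∧ X (n + 1) ω = a}).toReal
      = Q (w (Fin.last n)) a * (μ {ω | ∀ i : Fin (n + 1), X (i : ℕ) ω = w i}).toReal

/-- Bivariate empirical distribution of consecutive pairs of the sample `x 0, …, x n`. -/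
def empPair {A : Type*} [DecidableEq A] (x : ℕ → A) (n : ℕ) (a a' : A) : ℝ :=
  (∑ i ∈ Finset.range n, if x i = a ∧ x (i + 1) = a' then (1 : ℝ) else 0) / n

/-- First marginal of the bivariate empirical distribution. -/
def empFst {A : Type*} [Fintype A] [DecidableEq A] (x : ℕ → A) (n : ℕ) (a : A) : ℝ :=
  ∑ a', empPair x n a a'

/-- Second marginal of the bivariate empirical distribution. -/
def empSnd {A : Type*} [Fintype A] [DecidableEq A] (x : ℕ → A) (n : ℕ) (a' : A) : ℝ :=
  ∑ a, empPair x n a a'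

/-- Univariate empirical distribution of the sample `x 0, …, x (n-1)`. -/
def empOne {A : Type*} [DecidableEq A] (x : ℕ → A) (n : ℕ) (a : A) : ℝ :=
  (∑ i ∈ Finset.range n, if x i = a then (1 : ℝ) else 0) / n

/-- The plug-in estimator of the mutual information. -/
def pluginMI {A : Type*} [Fintype A] [DecidableEq A] (x : ℕ → A) (n : ℕ) : ℝ :=
  ent (empFst x n) + ent (empSnd x n) - ent (fun p : A × A => empPair x n p.1 p.2)

/-- The stationary mutual information `I_π(X₀; X₁)` of a chain with transition
matrix `Q` and stationary distribution `π`. -/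
def Ipi {A : Type*} [Fintype A] (Q : A → A → ℝ) (pi : A → ℝ) : ℝ :=
  ∑ a, ∑ a', pi a * Q a a' * Real.log (Q a a' / pi a')

/-- Convergence in distribution of real random variables. -/
def TendstoInDistribution {Ω : Type*} [MeasurableSpace Ω] (μ : Measure Ω)
    (W : ℕ → Ω → ℝ) (ν : Measure ℝ) : Prop :=
  ∀ f : BoundedContinuousFunction ℝ ℝ,
    Tendsto (fun n => ∫ ω, f (W n ω) ∂μ) atTop (𝓝 (∫ x, f x ∂ν))

/-- Chi-squared distribution with `s` degrees of freedom, as the Gamma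
distribution with shape `s/2` and rate `1/2`. -/
def chiSq (s : ℕ) : Measure ℝ := gammaMeasure ((s : ℝ) / 2) (1 / 2)

/-- Irreducibility and aperiodicity of a finite-state chain, expressed as
primitivity of its transition matrix. -/
def Primitive {A : Type*} [Fintype A] [DecidableEq A] (Q : Matrix A A ℝ) : Prop :=
  ∃ N : ℕ, 0 < N ∧ ∀ a a', 0 < (Q ^ N) a a'

/-- Relative entropy (Kullback–Leibler divergence, natural logarithm) between
probability vectors on a finite type. -/
def KLdiv {T : Type*} [Fintype T] (p q : T → ℝ) : ℝ :=
  ∑ t, p t * Real.log (p t / q t)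


/-- Path cylinder. -/
def cyl {Ω A : Type*} (X : ℕ → Ω → A) (n : ℕ) (w : ℕ → A) : Set Ω :=
  {ω | ∀ i ≤ n, X i ω = w i}

lemma cyl_step {Ω A : Type*} [MeasurableSpace Ω] [DecidableEq A]
    (μ : Measure Ω) (X : ℕ → Ω → A) (Q : A → A → ℝ) (hM : IsMarkov μ X Q)
    (n : ℕ) (w : ℕ → A) (y : A) :
    μ.real (cyl X (n+1) (Function.update w (n+1) y)) = Q (w n) y * μ.real (cyl X n w) := by
  have h := hM n (fun i => w i) y
  have e1 : {ω | ∀ i : Fin (n + 1), X (i : ℕ) ω = w i} = cyl X n w := by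
    ext ω
    constructor
    · intro h i hi
      exact h ⟨i, by omega⟩
    · intro h i
      exact h i (by omega)
  have e2 : {ω | (∀ i : Fin (n + 1), X (i : ℕ) ω = w i) ∧ X (n + 1) ω = y}
      = cyl X (n+1) (Function.update w (n+1) y) := by
    ext ω
    constructor
    · rintro ⟨h, h2⟩ i hi
      by_cases hin : i = n + 1
      · subst hin; simpa using h2
      · rw [Function.update_of_ne hin]
        exact h ⟨i, by omega⟩
    · intro h
      refine ⟨fun i => ?_, by simpa using h (n+1) le_rfl⟩
      have := h i (by omega)
      rwa [Function.update_of_ne (by omega)] at this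
  rw [e1, e2] at h
  simpa [Measure.real] using h

lemma max_ineq {Ω A : Type*} [MeasurableSpace Ω] [Fintype A] [DecidableEq A]
    (μ : Measure Ω) [IsProbabilityMeasure μ] (X : ℕ → Ω → A) (Q : A → A → ℝ)
    (hM : IsMarkov μ X Q) (h : A → A → ℝ) (hh : ∀ x y, 0 ≤ h x y)
    (hs : ∀ x, ∑ y, Q x y * h x y ≤ 1) (N : ℕ) :
    ∀ (n : ℕ) (w : ℕ → A) (l : ℝ), 0 ≤ l →
      μ.real (cyl X n w ∩ {ω | ∃ m ≤ N, 1 ≤ l * ∏ i ∈ range m, h (X (n+i) ω) (X (n+i+1) ω)})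
        ≤ l * μ.real (cyl X n w) := by
  induction N with
  | zero =>
    intro n w l hl
    by_cases h1 : 1 ≤ l
    · exact (measureReal_mono Set.inter_subset_left).trans
        (le_mul_of_one_le_left measureReal_nonneg h1)
    · have : {ω | ∃ m ≤ 0, 1 ≤ l * ∏ i ∈ range m, h (X (n+i) ω) (X (n+i+1) ω)} = ∅ := by
        ext ω
        simp only [Set.mem_ofPred_eq, Set.mem_empty_iff_false, iff_false]
        rintro ⟨m, hm, h2⟩
        obtain rfl : m = 0 := by omega
        simp at h2
        exact h1 h2
      rw [this]
      simp
      positivity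
  | succ N ih =>
    intro n w l hl
    by_cases h1 : 1 ≤ l
    · exact (measureReal_mono Set.inter_subset_left).trans
        (le_mul_of_one_le_left measureReal_nonneg h1)
    have hsub : cyl X n w ∩ {ω | ∃ m ≤ N+1, 1 ≤ l * ∏ i ∈ range m, h (X (n+i) ω) (X (n+i+1) ω)}
        ⊆ ⋃ y ∈ (Finset.univ : Finset A), (cyl X (n+1) (Function.update w (n+1) y) ∩
          {ω | ∃ m ≤ N, 1 ≤ (l * h (w n) y) *
            ∏ i ∈ range m, h (X (n+1+i) ω) (X (n+1+i+1) ω)}) := by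
      rintro ω ⟨hc, m, hm, h2⟩
      simp only [Set.mem_iUnion]
      refine ⟨X (n+1) ω, Finset.mem_univ _, ?_, ?_⟩
      · intro i hi
        by_cases hin : i = n + 1
        · subst hin; simp
        · rw [Function.update_of_ne hin]
          exact hc i (by omega)
      · cases m with
        | zero => simp at h2; exact absurd h2 h1
        | succ m =>
          refine ⟨m, by omega, ?_⟩
          rw [Finset.prod_range_succ'] at h2
          have e : ∀ i, n + 1 + i = n + (i + 1) := fun i => by omega
          simp only [e]
          simp only [add_zero] at h2
          rw [hc n le_rfl] at h2
          convert h2 using 1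
          ring
    calc _ ≤ _ := measureReal_mono hsub (measure_ne_top μ _)
      _ ≤ _ := measureReal_biUnion_finset_le _ _
      _ ≤ ∑ y, (l * h (w n) y) * (Q (w n) y * μ.real (cyl X n w)) := by
        refine Finset.sum_le_sum fun y _ => ?_
        rw [← cyl_step μ X Q hM]
        exact ih (n+1) _ _ (mul_nonneg hl (hh _ _))
      _ = l * μ.real (cyl X n w) * ∑ y, Q (w n) y * h (w n) y := by
        rw [Finset.mul_sum]
        refine Finset.sum_congr rfl fun y _ => by ring
      _ ≤ _ := mul_le_of_le_one_right (by positivity) (hs _)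

lemma max_ineq' {Ω A : Type*} [MeasurableSpace Ω] [Fintype A] [DecidableEq A]
    (μ : Measure Ω) [IsProbabilityMeasure μ] (X : ℕ → Ω → A) (Q : A → A → ℝ)
    (hM : IsMarkov μ X Q) (h : A → A → ℝ) (hh : ∀ x y, 0 ≤ h x y)
    (hs : ∀ x, ∑ y, Q x y * h x y ≤ 1) (N : ℕ) (l : ℝ) (hl : 0 ≤ l) :
      μ.real {ω | ∃ m ≤ N, 1 ≤ l * ∏ i ∈ range m, h (X i ω) (X (i+1) ω)}
        ≤ Fintype.card A * l := by
  have hsub : {ω | ∃ m ≤ N, 1 ≤ l * ∏ i ∈ range m, h (X i ω) (X (i+1) ω)} ⊆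
      ⋃ y ∈ (Finset.univ : Finset A), (cyl X 0 (fun _ => y) ∩
        {ω | ∃ m ≤ N, 1 ≤ l * ∏ i ∈ range m, h (X (0+i) ω) (X (0+i+1) ω)}) := by
    intro ω hω
    simp only [Set.mem_iUnion]
    refine ⟨X 0 ω, Finset.mem_univ _, ?_, by simpa using hω⟩
    intro i hi
    obtain rfl : i = 0 := by omega
    rfl
  calc _ ≤ _ := measureReal_mono hsub (measure_ne_top μ _)
    _ ≤ _ := measureReal_biUnion_finset_le _ _
    _ ≤ ∑ y : A, l := by
      refine Finset.sum_le_sum fun y _ => ?_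
      exact (max_ineq μ X Q hM h hh hs N 0 _ l hl).trans
        (mul_le_of_le_one_right hl measureReal_le_one)
    _ = _ := by simp

lemma hoeff {A : Type*} [Fintype A] (q d : A → ℝ) (c l : ℝ) (hc : 0 < c)
    (hq : ∀ y, 0 ≤ q y) (hq1 : ∑ y, q y = 1) (hd : ∑ y, q y * d y = 0)
    (hb : ∀ y, |d y| ≤ c) :
    ∑ y, q y * Real.exp (l * d y) ≤ Real.exp (l^2 * c^2 / 2) := by
  have key : ∀ y, Real.exp (l * d y) ≤ Real.cosh (l*c) + d y * (Real.sinh (l*c) / c) := by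
    intro y
    have hy := abs_le.1 (hb y)
    have hcv := convexOn_exp.2
    have := @hcv (l*c) (Set.mem_univ _) (-(l*c)) (Set.mem_univ _)
      ((c + d y)/(2*c)) ((c - d y)/(2*c))
      (div_nonneg (by linarith) (by linarith)) (div_nonneg (by linarith) (by linarith))
      (by field_simp; ring)
    simp only [smul_eq_mul] at this
    have e : (c + d y)/(2*c) * (l*c) + (c - d y)/(2*c) * (-(l*c)) = l * d y := by
      field_simp; ring
    rw [e] at this
    refine this.trans (le_of_eq ?_)
    rw [Real.cosh_eq, Real.sinh_eq]
    field_simp; ring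
  calc _ ≤ ∑ y, q y * (Real.cosh (l*c) + d y * (Real.sinh (l*c) / c)) :=
        Finset.sum_le_sum fun y _ => mul_le_mul_of_nonneg_left (key y) (hq y)
    _ = Real.cosh (l*c) * ∑ y, q y + (Real.sinh (l*c) / c) * ∑ y, q y * d y := by
        rw [Finset.mul_sum, Finset.mul_sum, ← Finset.sum_add_distrib]
        exact Finset.sum_congr rfl fun y _ => by ring
    _ = Real.cosh (l*c) := by rw [hq1, hd]; ring
    _ ≤ _ := by
        refine (Real.cosh_le_exp_half_sq _).trans (le_of_eq ?_)
        congr 1; ring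

/-- martingale part -/
def mart {A : Type*} [Fintype A] (Q : A → A → ℝ) (g : A → ℝ) (x : ℕ → A) (m : ℕ) : ℝ :=
  ∑ i ∈ range m, (g (x (i+1)) - ∑ y, Q (x i) y * g y)

lemma block {Ω A : Type*} [MeasurableSpace Ω] [Fintype A] [DecidableEq A]
    (μ : Measure Ω) [IsProbabilityMeasure μ] (X : ℕ → Ω → A) (Q : A → A → ℝ)
    (hM : IsMarkov μ X Q) (hQ : ∀ x y, 0 ≤ Q x y) (hQ1 : ∀ x, ∑ y, Q x y = 1)
    (g : A → ℝ) (c : ℝ) (hc : 0 < c) (hb : ∀ x y, |g y - ∑ z, Q x z * g z| ≤ c)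
    (N : ℕ) (l t : ℝ) (hl : 0 ≤ l) :
    μ.real {ω | ∃ m ≤ N, t ≤ mart Q g (fun i => X i ω) m} ≤
      Fintype.card A * Real.exp (l^2 * c^2 / 2 * N - l * t) := by
  refine le_trans (measureReal_mono ?_) (max_ineq' μ X Q hM
    (fun x y => Real.exp (l * (g y - ∑ z, Q x z * g z)) / Real.exp (l^2*c^2/2))
    (fun x y => by positivity) ?_ N _ (Real.exp_nonneg _))
  · rintro ω ⟨m, hm, h⟩
    refine ⟨m, hm, ?_⟩
    simp_rw [← Real.exp_sub]
    rw [← Real.exp_sum, ← Real.exp_add]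
    apply Real.one_le_exp
    rw [Finset.sum_sub_distrib, ← Finset.mul_sum]
    have e : ∑ i ∈ range m, (g (X (i+1) ω) - ∑ z, Q (X i ω) z * g z)
      = mart Q g (fun i => X i ω) m := rfl
    rw [e]
    simp only [sum_const, card_range, nsmul_eq_mul]
    have h1 : l * t ≤ l * mart Q g (fun i => X i ω) m := mul_le_mul_of_nonneg_left h hl
    have h2 : (m:ℝ) * (l^2*c^2/2) ≤ N * (l^2*c^2/2) :=
      mul_le_mul_of_nonneg_right (by exact_mod_cast hm) (by positivity)
    linarith
  · intro x
    simp_rw [← mul_div_assoc]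
    rw [← Finset.sum_div, div_le_one (Real.exp_pos _)]
    apply hoeff _ (fun y => g y - ∑ z, Q x z * g z) c l hc (hQ x) (hQ1 x) _ (hb x)
    simp_rw [mul_sub]
    rw [Finset.sum_sub_distrib, ← Finset.sum_mul, hQ1]
    simp

lemma lil_block {Ω A : Type*} [MeasurableSpace Ω] [Fintype A] [DecidableEq A]
    (μ : Measure Ω) [IsProbabilityMeasure μ] (X : ℕ → Ω → A) (Q : A → A → ℝ)
    (hM : IsMarkov μ X Q) (hQ : ∀ x y, 0 ≤ Q x y) (hQ1 : ∀ x, ∑ y, Q x y = 1)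
    (g : A → ℝ) :
    ∃ B : ℝ, 0 ≤ B ∧ ∀ᵐ ω ∂μ, ∀ᶠ k : ℕ in atTop, ∀ m ≤ 2^(k+1),
      mart Q g (fun i => X i ω) m ≤ B * Real.sqrt (2^(k+1) * Real.log k) := by
  obtain ⟨c, hc, hb⟩ : ∃ c : ℝ, 0 < c ∧ ∀ x y, |g y - ∑ z, Q x z * g z| ≤ c := by
    refine ⟨1 + ∑ x, ∑ y, |g y - ∑ z, Q x z * g z|, by positivity, fun x y => ?_⟩
    have h1 := Finset.single_le_sum (f := fun y => |g y - ∑ z, Q x z * g z|)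
      (fun y _ => abs_nonneg _) (Finset.mem_univ y)
    have h2 := Finset.single_le_sum (f := fun x => ∑ y, |g y - ∑ z, Q x z * g z|)
      (fun x _ => Finset.sum_nonneg fun y _ => abs_nonneg _) (Finset.mem_univ x)
    linarith
  refine ⟨2 + c^2/2, by positivity, ?_⟩
  have hbd : ∀ k : ℕ, μ {ω | ∃ m ≤ 2^(k+1), (2 + c^2/2) * Real.sqrt (2^(k+1) * Real.log k)
      ≤ mart Q g (fun i => X i ω) m} ≤ ENNReal.ofReal (Fintype.card A * (1 / (k:ℝ)^2) +
        if k = 0 then 1 else 0) := by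
    intro k
    rcases Nat.eq_zero_or_pos k with rfl | hk
    · refine prob_le_one.trans ?_
      simp
    have hk' : (0:ℝ) < k := by exact_mod_cast hk
    have hlog : 0 ≤ Real.log k := Real.log_natCast_nonneg k
    rw [← ENNReal.ofReal_toReal (measure_ne_top μ _)]
    apply ENNReal.ofReal_le_ofReal
    refine (block μ X Q hM hQ hQ1 g c hc hb (2^(k+1)) (Real.sqrt (Real.log k / 2^(k+1)))
      _ (Real.sqrt_nonneg _)).trans ?_
    rw [if_neg hk.ne', add_zero]
    refine mul_le_mul_of_nonneg_left (le_of_eq ?_) (by positivity)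
    have e1 : Real.sqrt (Real.log k / 2^(k+1)) * Real.sqrt (2^(k+1) * Real.log k) = Real.log k := by
      rw [← Real.sqrt_mul (by positivity)]
      rw [show Real.log k / 2^(k+1) * (2^(k+1) * Real.log k) = Real.log k ^ 2 by field_simp]
      exact Real.sqrt_sq hlog
    rw [Real.sq_sqrt (by positivity)]
    have e2 : Real.log k / 2^(k+1) * c^2/2 * ((2^(k+1) : ℕ):ℝ) - Real.sqrt (Real.log k / 2^(k+1)) *
      ((2 + c^2/2) * Real.sqrt (2^(k+1) * Real.log k)) = - (2 * Real.log k) := by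
      rw [show Real.sqrt (Real.log k / 2^(k+1)) *
        ((2 + c^2/2) * Real.sqrt (2^(k+1) * Real.log k)) = (2 + c^2/2) *
        (Real.sqrt (Real.log k / 2^(k+1)) * Real.sqrt (2^(k+1) * Real.log k)) by ring, e1]
      push_cast
      field_simp
      ring
    rw [e2, Real.exp_neg, two_mul, Real.exp_add, Real.exp_log hk']
    field_simp
  have hsum : Summable fun k : ℕ => (Fintype.card A * (1 / (k:ℝ)^2) +
        if k = 0 then (1:ℝ) else 0) := by
    refine Summable.add ((Real.summable_one_div_nat_pow.2 (by norm_num)).mul_left _) ?_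
    exact summable_of_ne_finset_zero (s := {0}) (fun b hb => by simp at hb; simp [hb])
  have hfin := ne_top_of_le_ne_top hsum.tsum_ofReal_ne_top (ENNReal.tsum_le_tsum hbd)
  filter_upwards [ae_eventually_notMem hfin] with ω hω
  filter_upwards [hω] with k hk m hm
  by_contra! hcon
  exact hk ⟨m, hm, hcon.le⟩

lemma lil {Ω A : Type*} [MeasurableSpace Ω] [Fintype A] [DecidableEq A]
    (μ : Measure Ω) [IsProbabilityMeasure μ] (X : ℕ → Ω → A) (Q : A → A → ℝ)
    (hM : IsMarkov μ X Q) (hQ : ∀ x y, 0 ≤ Q x y) (hQ1 : ∀ x, ∑ y, Q x y = 1)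
    (g : A → ℝ) :
    ∃ B : ℝ, 0 ≤ B ∧ ∀ᵐ ω ∂μ, ∀ᶠ n : ℕ in atTop,
      mart Q g (fun i => X i ω) n ≤ B * Real.sqrt (n * Real.log (Real.log n)) := by
  obtain ⟨B, hB, h⟩ := lil_block μ X Q hM hQ hQ1 g
  refine ⟨B * 2, by positivity, ?_⟩
  filter_upwards [h] with ω hω
  have ht : Tendsto (fun n : ℕ => Nat.log 2 n) atTop atTop := by
    refine tendsto_atTop.2 fun b => ?_
    filter_upwards [eventually_ge_atTop (2^b)] with n hn
    exact Nat.le_log_of_pow_le (by norm_num) hn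
  have hlog : Tendsto (fun n : ℕ => Real.log (n:ℝ)) atTop atTop :=
    Real.tendsto_log_atTop.comp tendsto_natCast_atTop_atTop
  filter_upwards [ht.eventually hω, hlog.eventually_ge_atTop 2, eventually_ge_atTop 2]
    with n h1 h2 h3
  have hlt : n < 2^(Nat.log 2 n + 1) := Nat.lt_pow_succ_log_self (by norm_num) n
  have hle : 2^(Nat.log 2 n) ≤ n := Nat.pow_log_le_self 2 (by omega)
  refine (h1 n hlt.le).trans ?_
  rw [mul_assoc]
  refine mul_le_mul_of_nonneg_left ?_ hB
  have hk1 : 1 ≤ Nat.log 2 n := Nat.le_log_of_pow_le (by norm_num) (by simpa using h3)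
  have hleR : (2:ℝ)^(Nat.log 2 n) ≤ n := by exact_mod_cast hle
  have hkl : (Nat.log 2 n : ℝ) * Real.log 2 ≤ Real.log n := by
    rw [← Real.log_pow]
    exact Real.log_le_log (by positivity) hleR
  have hlk : Real.log (Nat.log 2 n) ≤ 2 * Real.log (Real.log n) := by
    have h4 : (Nat.log 2 n : ℝ) ≤ 2 * Real.log n := by
      have := Real.log_two_gt_d9
      have h0 : (0:ℝ) ≤ Nat.log 2 n := by positivity
      nlinarith
    have h5 := Real.log_le_log (by exact_mod_cast hk1) h4
    rw [Real.log_mul (by norm_num) (by linarith)] at h5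
    have h6 := Real.log_le_log (by norm_num) h2
    linarith
  calc _ ≤ Real.sqrt (2^2 * (n * Real.log (Real.log n))) := by
        apply Real.sqrt_le_sqrt
        have h7 : (0:ℝ) ≤ Real.log (Nat.log 2 n) := Real.log_natCast_nonneg _
        calc (2:ℝ)^(Nat.log 2 n + 1) * Real.log (Nat.log 2 n)
            ≤ (2 * n) * (2 * Real.log (Real.log n)) := by
              apply mul_le_mul _ hlk h7 (by positivity)
              rw [pow_succ]; linarith
          _ = _ := by ring
    _ = _ := by
        rw [Real.sqrt_mul (by norm_num), Real.sqrt_sq (by norm_num)]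

lemma pow_stoch {A : Type*} [Fintype A] [DecidableEq A] (Q : Matrix A A ℝ) (g : A → ℝ)
    (h : Q.mulVec g = g) (N : ℕ) : (Q^N).mulVec g = g := by
  induction N with
  | zero => simp
  | succ N ih => rw [pow_succ, ← Matrix.mulVec_mulVec, h, ih]

lemma pow_stat {A : Type*} [Fintype A] [DecidableEq A] (Q : Matrix A A ℝ) (p : A → ℝ)
    (h : Matrix.vecMul p Q = p) (N : ℕ) : Matrix.vecMul p (Q^N) = p := by
  induction N with
  | zero => simp
  | succ N ih => rw [pow_succ, ← Matrix.vecMul_vecMul, ih, h]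

lemma pi_pos {A : Type*} [Fintype A] [DecidableEq A] (Q : Matrix A A ℝ) (pi : A → ℝ)
    (hIA : Primitive Q)
    (hpiNN : ∀ a, 0 ≤ pi a) (hpi1 : ∑ a, pi a = 1)
    (hpistat : ∀ a', ∑ a, pi a * Q a a' = pi a') (a : A) : 0 < pi a := by
  obtain ⟨N, -, hN⟩ := hIA
  have h := congrFun (pow_stat Q pi (funext fun a' => hpistat a') N) a
  rw [← h]
  obtain ⟨b, hb⟩ : ∃ b, 0 < pi b := by
    by_contra! hcon
    have : ∑ a, pi a ≤ 0 := Finset.sum_nonpos fun i _ => hcon i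
    linarith
  exact Finset.sum_pos' (fun i _ => mul_nonneg (hpiNN i) (hN i a).le)
    ⟨b, Finset.mem_univ _, mul_pos hb (hN b a)⟩

lemma harm_const {A : Type*} [Fintype A] [DecidableEq A] (Q : Matrix A A ℝ)
    (hQrow : ∀ a, ∑ a', Q a a' = 1)
    (hIA : Primitive Q) (g : A → ℝ) (h : Q.mulVec g = g) (x y : A) : g x = g y := by
  obtain ⟨N, -, hN⟩ := hIA
  have h1 := pow_stoch Q g h N
  have h2 := pow_stoch Q (fun _ => 1) (funext fun a => by simp [Matrix.mulVec, dotProduct, hQrow]) N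
  haveI : Nonempty A := ⟨x⟩
  obtain ⟨z, hz⟩ := Finite.exists_max g
  have h3 : ∑ w, (Q^N) z w * (g z - g w) = 0 := by
    have a1 := congrFun h1 z
    have a2 := congrFun h2 z
    simp only [Matrix.mulVec, dotProduct, mul_one] at a1 a2
    simp_rw [mul_sub]
    rw [Finset.sum_sub_distrib, ← Finset.sum_mul, a1, a2]
    ring
  have h4 := (Finset.sum_eq_zero_iff_of_nonneg
    (fun w _ => mul_nonneg (hN z w).le (sub_nonneg.2 (hz w)))).1 h3
  have h5 : ∀ w, g z = g w := fun w => by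
    rcases mul_eq_zero.1 (h4 w (Finset.mem_univ _)) with h | h
    · exact absurd h (hN z w).ne'
    · linarith
  rw [← h5 x, ← h5 y]

lemma poisson {A : Type*} [Fintype A] [DecidableEq A] (Q : Matrix A A ℝ) (pi : A → ℝ)
    (hQrow : ∀ a, ∑ a', Q a a' = 1)
    (hIA : Primitive Q) (hpi1 : ∑ a, pi a = 1)
    (hpistat : ∀ a', ∑ a, pi a * Q a a' = pi a') (f : A → ℝ) (hf : pi ⬝ᵥ f = 0) :
    ∃ g : A → ℝ, ∀ x, g x - ∑ y, Q x y * g y = f x := by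
  have hst : Matrix.vecMul pi Q = pi := funext fun a' => hpistat a'
  let T : (A → ℝ) →ₗ[ℝ] (A → ℝ) :=
    LinearMap.id - Q.mulVecLin +
      { toFun := fun g _ => pi ⬝ᵥ g
        map_add' := fun a b => by ext; simp [dotProduct_add]
        map_smul' := fun a b => by ext; simp [dotProduct_smul] }
  have hT : ∀ g x, T g x = g x - Q.mulVec g x + pi ⬝ᵥ g := fun g x => rfl
  have hpiT : ∀ g, pi ⬝ᵥ (T g) = pi ⬝ᵥ g := by
    intro g
    have : T g = g - Q.mulVec g + (pi ⬝ᵥ g) • (fun _ => (1:ℝ)) := by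
      ext x; simp [hT]
    rw [this, dotProduct_add, dotProduct_sub, Matrix.dotProduct_mulVec, hst, dotProduct_smul]
    have : pi ⬝ᵥ (fun _ => (1:ℝ)) = 1 := by simp [dotProduct, hpi1]
    rw [this]; simp
  have hinj : Function.Injective T := by
    rw [← LinearMap.ker_eq_bot, LinearMap.ker_eq_bot']
    intro g hg
    have h0 : pi ⬝ᵥ g = 0 := by rw [← hpiT, hg]; simp
    have h1 : Q.mulVec g = g := by
      ext x
      have := hT g x
      rw [hg, h0] at this
      simp at this; linarith
    ext x
    have h2 := harm_const Q hQrow hIA g h1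
    have : pi ⬝ᵥ g = g x := by
      simp only [dotProduct]
      rw [Finset.sum_congr rfl fun y _ => by rw [h2 y x], ← Finset.sum_mul, hpi1, one_mul]
    rw [← this, h0]; rfl
  obtain ⟨g, hg⟩ := LinearMap.injective_iff_surjective.1 hinj f
  refine ⟨g, fun x => ?_⟩
  have h1 := hT g x
  have h0 : pi ⬝ᵥ g = 0 := by rw [← hpiT, hg, hf]
  rw [hg, h0] at h1
  rw [h1]; simp [Matrix.mulVec, dotProduct]

lemma telescoping {A : Type*} [Fintype A] (Q : A → A → ℝ) (f g : A → ℝ)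
    (hg : ∀ x, g x - ∑ y, Q x y * g y = f x) (x : ℕ → A) (n : ℕ) :
    ∑ i ∈ range n, f (x i) = mart Q g x n + g (x 0) - g (x n) := by
  induction n with
  | zero => simp [mart]
  | succ n ih =>
    rw [Finset.sum_range_succ, ih, mart, mart, Finset.sum_range_succ, ← hg]
    ring

lemma mart_neg {A : Type*} [Fintype A] (Q : A → A → ℝ) (g : A → ℝ) (x : ℕ → A) (n : ℕ) :
    mart Q (-g) x n = - mart Q g x n := by
  simp only [mart, ← Finset.sum_neg_distrib, Pi.neg_apply, mul_neg]
  exact Finset.sum_congr rfl fun i _ => by rw [Finset.sum_neg_distrib]; ring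

lemma LL_large : ∀ᶠ n : ℕ in atTop, 1 ≤ n ∧ 1 ≤ Real.log (Real.log (n:ℝ)) := by
  have hlog : Tendsto (fun n : ℕ => Real.log (Real.log (n:ℝ))) atTop atTop :=
    Real.tendsto_log_atTop.comp (Real.tendsto_log_atTop.comp tendsto_natCast_atTop_atTop)
  exact (eventually_ge_atTop 1).and (hlog.eventually_ge_atTop 1)

lemma emp_dev {Ω A : Type*} [MeasurableSpace Ω] [Fintype A] [DecidableEq A]
    (μ : Measure Ω) [IsProbabilityMeasure μ] (X : ℕ → Ω → A) (Q : Matrix A A ℝ) (pi : A → ℝ)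
    (hQnn : ∀ a a', 0 ≤ Q a a') (hQrow : ∀ a, ∑ a', Q a a' = 1)
    (hMarkov : IsMarkov μ X fun a a' => Q a a')
    (hIA : Primitive Q) (hpi1 : ∑ a, pi a = 1)
    (hpistat : ∀ a', ∑ a, pi a * Q a a' = pi a') (a : A) :
    ∃ C : ℝ, ∀ᵐ ω ∂μ, ∀ᶠ n : ℕ in atTop,
      (empOne (fun i => X i ω) n a - pi a)^2 ≤ C * (Real.log (Real.log (n : ℝ)) / n) := by
  obtain ⟨g, hg⟩ := poisson Q pi hQrow hIA hpi1 hpistat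
    (fun x => (if x = a then 1 else 0) - pi a) (by
      simp [dotProduct, mul_sub, ← Finset.sum_mul, hpi1])
  obtain ⟨B1, hB1, h1⟩ := lil μ X _ hMarkov hQnn hQrow g
  obtain ⟨B2, hB2, h2⟩ := lil μ X _ hMarkov hQnn hQrow (-g)
  set G := ∑ x, |g x| with hG
  have hGx : ∀ x, |g x| ≤ G := fun x =>
    Finset.single_le_sum (f := fun x => |g x|) (fun y _ => abs_nonneg _) (Finset.mem_univ x)
  refine ⟨(B1 + B2 + 2 * G)^2, ?_⟩
  filter_upwards [h1, h2] with ω hω1 hω2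
  filter_upwards [hω1, hω2, LL_large] with n hn1 hn2 hn3
  obtain ⟨hn, hLL⟩ := hn3
  have hnR : (1:ℝ) ≤ n := by exact_mod_cast hn
  have ht := telescoping (fun a a' => Q a a') _ g hg (fun i => X i ω) n
  rw [mart_neg] at hn2
  set M := mart (fun a a' => Q a a') g (fun i => X i ω) n
  set s := Real.sqrt (n * Real.log (Real.log n)) with hs
  have hs1 : 1 ≤ s := by
    rw [hs, Real.one_le_sqrt]
    nlinarith
  have hs2 : s^2 = n * Real.log (Real.log n) := Real.sq_sqrt (by nlinarith)
  have he : empOne (fun i => X i ω) n a - pi a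
      = (M + g (X 0 ω) - g (X n ω)) / n := by
    rw [← ht, empOne, Finset.sum_sub_distrib]
    simp
    field_simp
  rw [he]
  have g0 := abs_le.1 (hGx (X 0 ω))
  have gn := abs_le.1 (hGx (X n ω))
  have hG0 : 0 ≤ G := (abs_nonneg _).trans (hGx (X 0 ω))
  have hGs : G ≤ G * s := le_mul_of_one_le_right hG0 hs1
  have habs : |M + g (X 0 ω) - g (X n ω)| ≤ (B1 + B2 + 2 * G) * s := by
    have b1 : 0 ≤ B1 * s := by positivity
    have b2 : 0 ≤ B2 * s := by positivity
    rw [abs_le]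
    constructor <;> nlinarith
  have hsq : (M + g (X 0 ω) - g (X n ω))^2 ≤ ((B1 + B2 + 2 * G) * s)^2 := by
    rw [← sq_abs]
    exact pow_le_pow_left₀ (abs_nonneg _) habs 2
  rw [div_pow, mul_pow, hs2] at *
  calc _ ≤ ((B1 + B2 + 2 * G)^2 * (n * Real.log (Real.log n))) / (n:ℝ)^2 :=
        div_le_div_of_nonneg_right hsq (by positivity)
    _ = _ := by field_simp

lemma kl_upper {A : Type*} [Fintype A] (p q : A → ℝ) (hp : ∀ a, 0 ≤ p a) (hq : ∀ a, 0 < q a)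
    (hp1 : ∑ a, p a = 1) (hq1 : ∑ a, q a = 1) :
    KLdiv p q ≤ ∑ a, (p a - q a)^2 / q a := by
  have h : KLdiv p q ≤ ∑ a, ((p a - q a)^2 / q a + (p a - q a)) := by
    refine Finset.sum_le_sum fun a _ => ?_
    have := hq a
    rcases (hp a).eq_or_lt with h0 | h0
    · rw [← h0]; simp; field_simp; simp
    · calc _ ≤ p a * (p a / q a - 1) :=
            mul_le_mul_of_nonneg_left (Real.log_le_sub_one_of_pos (by positivity)) (hp a)
        _ = _ := by field_simp; ring
  rw [Finset.sum_add_distrib, Finset.sum_sub_distrib, hp1, hq1] at h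
  linarith

lemma kl_nonneg {A : Type*} [Fintype A] (p q : A → ℝ) (hp : ∀ a, 0 ≤ p a) (hq : ∀ a, 0 < q a)
    (hp1 : ∑ a, p a = 1) (hq1 : ∑ a, q a = 1) : 0 ≤ KLdiv p q := by
  have h : ∑ a, (p a - q a) ≤ KLdiv p q := by
    refine Finset.sum_le_sum fun a _ => ?_
    have := hq a
    rcases (hp a).eq_or_lt with h0 | h0
    · rw [← h0]; simp; exact this.le
    · calc _ = p a * (1 - (p a / q a)⁻¹) := by field_simp
        _ ≤ _ := mul_le_mul_of_nonneg_left (Real.one_sub_inv_le_log_of_pos (by positivity)) (hp a)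
  rw [Finset.sum_sub_distrib, hp1, hq1] at h
  linarith

lemma emp_sum {A : Type*} [Fintype A] [DecidableEq A] (x : ℕ → A) (n : ℕ) (hn : 1 ≤ n) :
    ∑ a, empOne x n a = 1 := by
  have : (n:ℝ) ≠ 0 := by positivity
  simp only [empOne]
  rw [← Finset.sum_div, Finset.sum_comm]
  simp [this]

lemma emp_nonneg {A : Type*} [DecidableEq A] (x : ℕ → A) (n : ℕ) (a : A) :
    0 ≤ empOne x n a := by
  unfold empOne; positivity

lemma LL_div_tendsto :
    Tendsto (fun n : ℕ => Real.log (Real.log (n:ℝ)) / n) atTop (𝓝 0) := by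
  have h : Tendsto (fun n : ℕ => Real.log (n:ℝ) / n) atTop (𝓝 0) :=
    (Real.isLittleO_log_id_atTop.tendsto_div_nhds_zero).comp tendsto_natCast_atTop_atTop
  refine squeeze_zero' ?_ ?_ h
  · filter_upwards [LL_large] with n hn
    exact div_nonneg (by linarith [hn.2]) (by positivity)
  · filter_upwards with n
    exact div_le_div_of_nonneg_right
      (Real.log_le_self (Real.log_natCast_nonneg n)) (by positivity)

/-- For an irreducible and aperiodic chain, the relative entropy between the
empirical distribution and the stationary distribution satisfies
`√(n / log log n) · D(P̂_{X₀,n} ‖ π) → 0` almost surely; in particular it is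
`O(log log n / n)` almost surely. -/
theorem stmt17 {Ω A : Type*} [MeasurableSpace Ω]
    [MeasurableSpace A] [Fintype A] [DecidableEq A]
    (μ : Measure Ω) [IsProbabilityMeasure μ]
    (X : ℕ → Ω → A) (Q : Matrix A A ℝ) (pi : A → ℝ)
    (hXmeas : ∀ i, Measurable (X i))
    (hQnn : ∀ a a', 0 ≤ Q a a') (hQrow : ∀ a, ∑ a', Q a a' = 1)
    (hMarkov : IsMarkov μ X fun a a' => Q a a')
    (hIA : Primitive Q)
    (hpiNN : ∀ a, 0 ≤ pi a) (hpi1 : ∑ a, pi a = 1)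
    (hpistat : ∀ a', ∑ a, pi a * Q a a' = pi a') :
    (∀ᵐ ω ∂μ, Tendsto (fun n : ℕ =>
        Real.sqrt ((n : ℝ) / Real.log (Real.log (n : ℝ)))
          * KLdiv (empOne (fun i => X i ω) n) pi) atTop (𝓝 0)) ∧
    ∀ᵐ ω ∂μ, ∃ C : ℝ, ∀ᶠ n : ℕ in atTop,
      KLdiv (empOne (fun i => X i ω) n) pi
        ≤ C * (Real.log (Real.log (n : ℝ)) / n) := by
  have hpos := pi_pos Q pi hIA hpiNN hpi1 hpistat
  have main : ∀ᵐ ω ∂μ, ∃ C : ℝ, ∀ᶠ n : ℕ in atTop,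
      KLdiv (empOne (fun i => X i ω) n) pi
        ≤ C * (Real.log (Real.log (n : ℝ)) / n) := by
    choose C hC using emp_dev μ X Q pi hQnn hQrow hMarkov hIA hpi1 hpistat
    filter_upwards [ae_all_iff.2 hC] with ω hω
    refine ⟨∑ a, C a / pi a, ?_⟩
    filter_upwards [eventually_all.2 hω, eventually_ge_atTop 1] with n hn hn1
    refine (kl_upper _ _ (emp_nonneg _ n) hpos (emp_sum _ n hn1) hpi1).trans ?_
    rw [Finset.sum_mul]
    refine Finset.sum_le_sum fun a _ => ?_
    rw [div_mul_eq_mul_div]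
    exact div_le_div_of_nonneg_right (hn a) (hpiNN a)
  refine ⟨?_, main⟩
  filter_upwards [main] with ω hω
  obtain ⟨C, hC⟩ := hω
  have hlim : Tendsto (fun n : ℕ => C * Real.sqrt (Real.log (Real.log (n:ℝ)) / n))
      atTop (𝓝 0) := by
    simpa using ((Real.continuous_sqrt.tendsto 0).comp LL_div_tendsto).const_mul C
  refine squeeze_zero' ?_ ?_ hlim
  · filter_upwards [eventually_ge_atTop 1] with n hn
    exact mul_nonneg (Real.sqrt_nonneg _)
      (kl_nonneg _ _ (emp_nonneg _ n) hpos (emp_sum _ n hn) hpi1)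
  · filter_upwards [hC, LL_large] with n hn hL
    obtain ⟨hn1, hL⟩ := hL
    have hn0 : (0:ℝ) < n := by exact_mod_cast hn1
    have hL0 : 0 < Real.log (Real.log (n:ℝ)) := by linarith
    refine (mul_le_mul_of_nonneg_left hn (Real.sqrt_nonneg _)).trans (le_of_eq ?_)
    set r := Real.log (Real.log (n:ℝ)) / n with hr
    have hr0 : 0 < r := by positivity
    rw [show (n:ℝ) / Real.log (Real.log (n:ℝ)) = r⁻¹ by rw [hr, inv_div], Real.sqrt_inv]
    have h1 : Real.sqrt r ≠ 0 := (Real.sqrt_pos.2 hr0).ne'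
    have h2 : Real.sqrt r * Real.sqrt r = r := Real.mul_self_sqrt hr0.le
    nth_rewrite 2 [← h2]
    field_simp

end
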